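/- arXiv:1801.04563 — 3 statements merged into one kernel-verified Lean document; each statement's English description precedes it below -/
import Mathlib

section
/- For integers d, r with d > 2r ≥ 4, the quantity (2d)!/(2d−2r−2)! − 4·d!·(2d−r)!/((d−r)!·(2d−2r−2)!) + 2·(d!/(d−r)!)²·(2d−2r)(2d−2r−1) + (d!/(d−2r)!)·(2d−2r)(2d−2r−1) is nonzero (in particular the first term exceeds the second). -/
theorem aux_lt (d r : ℕ) (hr : 2 ≤ r) (hd : r < d) :
    4 * d.descFactorial r < (2 * d).descFactorial r := by
  induction r, hr using Nat.le_induction with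
  | base =>
    obtain ⟨k, rfl⟩ : ∃ k, d = k + 1 := ⟨d - 1, by omega⟩
    have h : 2 * (k + 1) - 1 = 2 * k + 1 := by omega
    simp only [Nat.descFactorial_succ, Nat.descFactorial_zero, h, Nat.add_sub_cancel, Nat.sub_zero]
    nlinarith
  | succ r hr ih =>
    have ih := ih (by omega)
    rw [Nat.descFactorial_succ, Nat.descFactorial_succ]
    calc 4 * ((d - r) * d.descFactorial r) = (d - r) * (4 * d.descFactorial r) := by ring
      _ < (d - r) * (2 * d).descFactorial r := Nat.mul_lt_mul_of_pos_left ih (by omega)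
      _ ≤ (2 * d - r) * (2 * d).descFactorial r := Nat.mul_le_mul_right _ (by omega)

/- Here `n.descFactorial k = n!/(n-k)!`, so e.g. `(2d)!/(2d-2r-2)! = (2d).descFactorial (2r+2)`. -/
theorem stmt3 (d r : ℕ) (hr : 2 ≤ r) (hd : 2 * r < d) :
    (((2 * d).descFactorial (2 * r + 2) : ℤ)
        - 4 * (d.descFactorial r) * ((2 * d - r).descFactorial (r + 2))
        + 2 * (d.descFactorial r) * (d.descFactorial r) * (2 * d - 2 * r) * (2 * d - 2 * r - 1)
        + (d.descFactorial (2 * r)) * (2 * d - 2 * r) * (2 * d - 2 * r - 1) ≠ 0) ∧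
    (4 * (d.descFactorial r) * ((2 * d - r).descFactorial (r + 2)) : ℤ)
      < ((2 * d).descFactorial (2 * r + 2) : ℤ) := by
  have key : (4 * (d.descFactorial r) * ((2 * d - r).descFactorial (r + 2)) : ℤ)
      < ((2 * d).descFactorial (2 * r + 2) : ℤ) := by
    have h1 : (2 * d).descFactorial (2 * r + 2)
        = (2 * d - r).descFactorial (r + 2) * (2 * d).descFactorial r := by
      have := Nat.descFactorial_mul_descFactorial (n := 2 * d) (k := r) (m := 2 * r + 2) (by omega)
      rw [← this]
      congr 2
      omega
    have h2 : 0 < (2 * d - r).descFactorial (r + 2) :=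
      Nat.pos_of_ne_zero (by rw [Ne, Nat.descFactorial_eq_zero_iff_lt]; omega)
    have h3 := Nat.mul_lt_mul_of_pos_left (aux_lt d r hr (by omega)) h2
    rw [← h1, mul_comm] at h3
    exact_mod_cast h3
  refine ⟨?_, key⟩
  have a1 : (0 : ℤ) ≤ 2 * d - 2 * r := by omega
  have a2 : (0 : ℤ) ≤ 2 * d - 2 * r - 1 := by omega
  have b1 : (0 : ℤ) ≤ 2 * (d.descFactorial r) * (d.descFactorial r) * (2 * d - 2 * r) * (2 * d - 2 * r - 1) :=
    mul_nonneg (mul_nonneg (by positivity) a1) a2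
  have b2 : (0 : ℤ) ≤ (d.descFactorial (2 * r)) * (2 * d - 2 * r) * (2 * d - 2 * r - 1) :=
    mul_nonneg (mul_nonneg (by positivity) a1) a2
  apply ne_of_gt
  linarith
end

section
/- Let K be a field of characteristic zero, and let f(x) = a₁x be linear in x and g ∈ K[y]. Set P = f + g and Λ = (∂x − Φ(∂y))∂y where Φ ∈ K[t] has order r ≥ 2 and r ≥ deg g. Then for all a, b ≥ 0 and all m > b + a·r, Λ^m(P^m · x^a y^b) = 0. -/
/-- The partial derivative ∂x as a linear endomorphism of K[x,y]. -/
noncomputable def Dx (K : Type*) [CommRing K] : Module.End K (MvPolynomial (Fin 2) K) :=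
  (MvPolynomial.pderiv (0 : Fin 2)).toLinearMap

/-- The partial derivative ∂y as a linear endomorphism of K[x,y]. -/
noncomputable def Dy (K : Type*) [CommRing K] : Module.End K (MvPolynomial (Fin 2) K) :=
  (MvPolynomial.pderiv (1 : Fin 2)).toLinearMap

/-- The operator Λ = (∂x − Φ(∂y))∂y on K[x,y]. -/
noncomputable def Lam (K : Type*) [CommRing K] (Φ : Polynomial K) :
    Module.End K (MvPolynomial (Fin 2) K) :=
  (Dx K - Polynomial.aeval (Dy K) Φ) * Dy K

/-- Polynomials all of whose monomials have weight `r * deg_x + deg_y` less than `n`. -/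
def WW (K : Type*) [Field K] (r n : ℕ) : Submodule K (MvPolynomial (Fin 2) K) where
  carrier := {p | ∀ s : Fin 2 →₀ ℕ, MvPolynomial.coeff s p ≠ 0 → r * s 0 + s 1 < n}
  zero_mem' := by intro s hs; simp at hs
  add_mem' := by
    intro p q hp hq s hs
    by_cases h : MvPolynomial.coeff s p = 0
    · refine hq s ?_
      intro h'
      simp [h, h'] at hs
    · exact hp s h
  smul_mem' := by
    intro c p hp s hs
    refine hp s ?_
    intro h'
    simp [h'] at hs

section
variable {K : Type*} [Field K] {r : ℕ}

lemma WW_mono {n m : ℕ} (h : n ≤ m) {p : MvPolynomial (Fin 2) K} (hp : p ∈ WW K r n) :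
    p ∈ WW K r m := fun s hs => (hp s hs).trans_le h

lemma WW_monomial (s : Fin 2 →₀ ℕ) (c : K) (n : ℕ) (h : r * s 0 + s 1 < n) :
    MvPolynomial.monomial s c ∈ WW K r n := by
  classical
  intro t ht
  rw [MvPolynomial.coeff_monomial] at ht
  split_ifs at ht with h1
  · subst h1; exact h
  · exact absurd rfl ht

lemma WW_zero {p : MvPolynomial (Fin 2) K} (hp : p ∈ WW K r 0) : p = 0 := by
  ext s
  by_contra h
  exact absurd (hp s (by simpa using h)) (by omega)

lemma WW_mul {k l : ℕ} {p q : MvPolynomial (Fin 2) K} (hp : p ∈ WW K r (k+1))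
    (hq : q ∈ WW K r (l+1)) : p * q ∈ WW K r (k+l+1) := by
  classical
  intro s hs
  have h := MvPolynomial.support_mul p q (MvPolynomial.mem_support_iff.2 hs)
  obtain ⟨u, hu, v, hv, rfl⟩ := Finset.mem_add.1 h
  have h1 := hp u (MvPolynomial.mem_support_iff.1 hu)
  have h2 := hq v (MvPolynomial.mem_support_iff.1 hv)
  simp only [Finsupp.add_apply, mul_add]
  omega

lemma WW_pow {k : ℕ} {p : MvPolynomial (Fin 2) K} (hp : p ∈ WW K r (k+1)) (m : ℕ) :
    p ^ m ∈ WW K r (m*k+1) := by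
  induction m with
  | zero => 
    rw [pow_zero]
    exact WW_monomial 0 1 _ (by simp)
  | succ m ih =>
    rw [pow_succ]
    refine WW_mono ?_ (WW_mul ih hp)
    rw [Nat.succ_mul]

lemma WW_X0 : (MvPolynomial.X 0 : MvPolynomial (Fin 2) K) ∈ WW K r (r+1) :=
  WW_monomial _ _ _ (by simp)

lemma WW_X1 : (MvPolynomial.X 1 : MvPolynomial (Fin 2) K) ∈ WW K r (1+1) :=
  WW_monomial _ _ _ (by simp)

lemma WW_pderiv (i : Fin 2) (w : ℕ) (hw : ∀ s : Fin 2 →₀ ℕ, s i ≠ 0 →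
    r * (s - Finsupp.single i 1 : Fin 2 →₀ ℕ) 0 + (s - Finsupp.single i 1 : Fin 2 →₀ ℕ) 1 + w = r * s 0 + s 1)
    {n : ℕ} {p : MvPolynomial (Fin 2) K} (hp : p ∈ WW K r n) :
    MvPolynomial.pderiv i p ∈ WW K r (n - w) := by
  rw [p.as_sum, map_sum]
  refine Submodule.sum_mem _ fun s hs => ?_
  rw [MvPolynomial.pderiv_monomial]
  by_cases h : s i = 0
  · simp [h]
  · apply WW_monomial
    have := hw s h
    have := hp s (MvPolynomial.mem_support_iff.1 hs)
    omega

lemma WW_Dx {n : ℕ} {p : MvPolynomial (Fin 2) K} (hp : p ∈ WW K r n) :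
    Dx K p ∈ WW K r (n - r) := by
  refine WW_pderiv 0 r ?_ hp
  intro s hs
  obtain ⟨k, hk⟩ := Nat.exists_eq_succ_of_ne_zero hs
  simp [hk]
  ring

lemma WW_Dy {n : ℕ} {p : MvPolynomial (Fin 2) K} (hp : p ∈ WW K r n) :
    Dy K p ∈ WW K r (n - 1) := by
  refine WW_pderiv 1 1 ?_ hp
  intro s hs
  obtain ⟨k, hk⟩ := Nat.exists_eq_succ_of_ne_zero hs
  simp [hk]
  ring

lemma WW_Dy_pow {n : ℕ} {p : MvPolynomial (Fin 2) K} (hp : p ∈ WW K r n) (j : ℕ) :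
    (Dy K ^ j) p ∈ WW K r (n - j) := by
  induction j with
  | zero => simpa using hp
  | succ j ih =>
    rw [pow_succ', Module.End.mul_apply]
    exact WW_mono (by omega) (WW_Dy ih)

lemma WW_Lam {Φ : Polynomial K} (hr : Φ.natTrailingDegree = r) {n : ℕ}
    {p : MvPolynomial (Fin 2) K} (hp : p ∈ WW K r n) :
    Lam K Φ p ∈ WW K r (n - (r + 1)) := by
  rw [Lam, Module.End.mul_apply, LinearMap.sub_apply]
  have h1 := WW_Dy hp
  refine Submodule.sub_mem _ (WW_mono (by omega) (WW_Dx h1)) ?_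
  rw [Polynomial.aeval_eq_sum_range, LinearMap.sum_apply]
  refine Submodule.sum_mem _ fun i _ => ?_
  rw [LinearMap.smul_apply]
  by_cases h : i < r
  · rw [Polynomial.coeff_eq_zero_of_lt_natTrailingDegree (hr ▸ h), zero_smul]
    exact Submodule.zero_mem _
  · exact Submodule.smul_mem _ _ (WW_mono (by omega) (WW_Dy_pow h1 i))

lemma WW_Lam_pow {Φ : Polynomial K} (hr : Φ.natTrailingDegree = r) {n : ℕ}
    {p : MvPolynomial (Fin 2) K} (hp : p ∈ WW K r n) (m : ℕ) :
    (Lam K Φ ^ m) p ∈ WW K r (n - m * (r + 1)) := by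
  induction m with
  | zero => simpa using hp
  | succ m ih =>
    rw [pow_succ', Module.End.mul_apply]
    refine WW_mono ?_ (WW_Lam hr ih)
    rw [Nat.succ_mul]
    omega

end

theorem stmt10 (K : Type*) [Field K] [CharZero K] (Φ : Polynomial K) (hΦ : Φ ≠ 0)
    (r : ℕ) (hr : Φ.natTrailingDegree = r) (hr2 : 2 ≤ r)
    (a₁ : K) (g : Polynomial K) (hg : g.natDegree ≤ r)
    (P : MvPolynomial (Fin 2) K)
    (hP : P = MvPolynomial.C a₁ * MvPolynomial.X (0 : Fin 2)
            + Polynomial.aeval (MvPolynomial.X (1 : Fin 2)) g) :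
    ∀ a b m : ℕ, b + a * r < m →
      (Lam K Φ ^ m)
        (P ^ m * MvPolynomial.X (0 : Fin 2) ^ a * MvPolynomial.X (1 : Fin 2) ^ b) = 0 := by
  intro a b m hm
  have h1 : P ∈ WW K r (r+1) := by
    rw [hP]
    refine Submodule.add_mem _ ?_ ?_
    · rw [← MvPolynomial.smul_eq_C_mul]
      exact Submodule.smul_mem _ _ WW_X0
    · rw [Polynomial.aeval_eq_sum_range]
      refine Submodule.sum_mem _ fun i hi => Submodule.smul_mem _ _ ?_
      have := Finset.mem_range.1 hi
      exact WW_mono (by omega) (WW_pow WW_X1 i)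
  have h2 := WW_Lam_pow hr
    (WW_mul (WW_mul (WW_pow h1 m) (WW_pow (WW_X0 (r := r)) a)) (WW_pow (WW_X1 (r := r)) b)) m
  refine WW_zero (r := r) (WW_mono ?_ h2)
  rw [Nat.mul_add m r 1]
  omega
end

section
/- Let K be a field of characteristic zero and Λ = (∂x − Φ(∂y))∂y with Φ ∈ K[t]. For any P ∈ K[x,y]: if Λ^m(P^m) = 0 for all m ≥ 1, then for every Q ∈ K[x,y] there exists N such that Λ^m(P^m Q) = 0 for all m ≥ N. -/
open MvPolynomial

namespace GVC

variable {K : Type*} [Field K]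

noncomputable def pt (i j : ℕ) : Fin 2 →₀ ℕ := Finsupp.single 0 i + Finsupp.single 1 j

@[simp] lemma pt_zero (i j : ℕ) : pt i j 0 = i := by simp [pt]
@[simp] lemma pt_one (i j : ℕ) : pt i j 1 = j := by simp [pt]

lemma eq_pt (d : Fin 2 →₀ ℕ) : d = pt (d 0) (d 1) := by
  ext k; fin_cases k <;> simp

noncomputable def cf (F : MvPolynomial (Fin 2) K) (i j : ℕ) : K := coeff (pt i j) F

@[simp] lemma cf_add (F G : MvPolynomial (Fin 2) K) (i j : ℕ) :
    cf (F + G) i j = cf F i j + cf G i j := by simp [cf]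
@[simp] lemma cf_sub (F G : MvPolynomial (Fin 2) K) (i j : ℕ) :
    cf (F - G) i j = cf F i j - cf G i j := by simp [cf]
@[simp] lemma cf_neg (F : MvPolynomial (Fin 2) K) (i j : ℕ) :
    cf (-F) i j = - cf F i j := by simp [cf]
@[simp] lemma cf_smul (a : K) (F : MvPolynomial (Fin 2) K) (i j : ℕ) :
    cf (a • F) i j = a * cf F i j := by simp [cf]
@[simp] lemma cf_zero (i j : ℕ) : cf (0 : MvPolynomial (Fin 2) K) i j = 0 := by simp [cf]

lemma cf_ext {F : MvPolynomial (Fin 2) K} (h : ∀ i j, cf F i j = 0) : F = 0 := by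
  ext d
  rw [eq_pt d]; simpa [cf] using h (d 0) (d 1)

lemma cf_mul (F G : MvPolynomial (Fin 2) K) (i j : ℕ) :
    cf (F * G) i j = ∑ a ∈ Finset.HasAntidiagonal.antidiagonal i, ∑ b ∈ Finset.HasAntidiagonal.antidiagonal j,
      cf F a.1 b.1 * cf G a.2 b.2 := by
  unfold cf
  rw [coeff_mul, ← Finset.sum_product']
  refine Finset.sum_nbij' (fun p => ((p.1 0, p.2 0), (p.1 1, p.2 1)))
    (fun q => (pt q.1.1 q.2.1, pt q.1.2 q.2.2)) ?_ ?_ ?_ ?_ ?_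
  · rintro ⟨p, q⟩ h
    simp only [Finset.HasAntidiagonal.mem_antidiagonal, Finset.mem_product] at h ⊢
    constructor
    · rw [← Finsupp.add_apply, h, pt_zero]
    · rw [← Finsupp.add_apply, h, pt_one]
  · rintro ⟨⟨a, b⟩, ⟨c, d⟩⟩ h
    simp only [Finset.HasAntidiagonal.mem_antidiagonal, Finset.mem_product] at h ⊢
    ext k; fin_cases k <;> simp [h.1, h.2]
  · rintro ⟨p, q⟩ h
    simp [← eq_pt]
  · rintro ⟨⟨a, b⟩, ⟨c, d⟩⟩ h
    simp
  · rintro ⟨p, q⟩ h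
    simp [← eq_pt]

lemma cf_Dx (F : MvPolynomial (Fin 2) K) (i j : ℕ) :
    cf (Dx K F) i j = (i + 1) * cf F (i + 1) j := by
  have : pt i j + Finsupp.single 0 1 = pt (i+1) j := by
    ext k; fin_cases k <;> simp
  simp [Dx, cf, coeff_pderiv, this, mul_comm]

lemma cf_Dy (F : MvPolynomial (Fin 2) K) (i j : ℕ) :
    cf (Dy K F) i j = (j + 1) * cf F i (j + 1) := by
  have : pt i j + Finsupp.single 1 1 = pt i (j+1) := by
    ext k; fin_cases k <;> simp
  simp [Dy, cf, coeff_pderiv, this, mul_comm]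

lemma cf_Dy_pow (k : ℕ) (F : MvPolynomial (Fin 2) K) (i j : ℕ) :
    cf ((Dy K ^ k) F) i j = ((j + k).descFactorial k : ℕ) * cf F i (j + k) := by
  induction k generalizing j with
  | zero => simp
  | succ k ih =>
    rw [pow_succ', Module.End.mul_apply, cf_Dy, ih]
    have : (j + (k + 1)).descFactorial (k + 1) = (j + 1) * (j + 1 + k).descFactorial k := by
      rw [Nat.descFactorial_succ, show j + (k+1) - k = j + 1 by omega,
        show j + (k+1) = j + 1 + k by omega]
    rw [this, show j + (k+1) = j + 1 + k by omega]
    push_cast; ring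

/-- weight filtration -/
def Fil (w v : ℕ) (n : ℤ) (F : MvPolynomial (Fin 2) K) : Prop :=
  ∀ i j : ℕ, n < (w * i + v * j : ℤ) → cf F i j = 0

variable {w v : ℕ} {n k : ℤ} {F G : MvPolynomial (Fin 2) K}

lemma Fil.mono (h : Fil w v n F) (hk : n ≤ k) : Fil w v k F :=
  fun i j hij => h i j (by omega)

lemma Fil.add (h : Fil w v n F) (h' : Fil w v n G) : Fil w v n (F + G) :=
  fun i j hij => by simp [h i j hij, h' i j hij]
lemma Fil.sub (h : Fil w v n F) (h' : Fil w v n G) : Fil w v n (F - G) :=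
  fun i j hij => by simp [h i j hij, h' i j hij]
lemma Fil.smul (a : K) (h : Fil w v n F) : Fil w v n (a • F) :=
  fun i j hij => by simp [h i j hij]

lemma Fil.mul (h : Fil w v n F) (h' : Fil w v k G) : Fil w v (n + k) (F * G) := by
  intro i j hij
  rw [cf_mul]
  refine Finset.sum_eq_zero fun a ha => Finset.sum_eq_zero fun b hb => ?_
  simp only [Finset.HasAntidiagonal.mem_antidiagonal] at ha hb
  by_cases h1 : n < (w * a.1 + v * b.1 : ℤ)
  · rw [h _ _ h1, zero_mul]
  · rw [h' a.2 b.2, mul_zero]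
    subst ha; subst hb
    push_cast at hij
    nlinarith

lemma Fil.pow (h : Fil w v n F) (m : ℕ) : Fil w v (m * n) (F ^ m) := by
  induction m with
  | zero =>
    intro i j hij
    have : ¬ (0 = pt i j) := by
      intro h0
      have e0 := DFunLike.congr_fun h0 0
      have e1 := DFunLike.congr_fun h0 1
      simp at e0 e1
      subst e0; subst e1; simp at hij
    simp [cf, coeff_one, this]
  | succ m ih =>
    rw [pow_succ]
    convert ih.mul h using 1
    push_cast; ring

lemma Fil.Dx (h : Fil w v n F) : Fil w v (n - w) (Dx K F) := by
  intro i j hij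
  rw [cf_Dx, h _ _ (by push_cast; linarith), mul_zero]

lemma Fil.Dy (h : Fil w v n F) : Fil w v (n - v) (Dy K F) := by
  intro i j hij
  rw [cf_Dy, h _ _ (by push_cast; linarith), mul_zero]

lemma Fil.Dy_pow (h : Fil w v n F) (m : ℕ) : Fil w v (n - m * v) ((_root_.Dy K ^ m) F) := by
  intro i j hij
  rw [cf_Dy_pow, h _ _ (by push_cast; linarith), mul_zero]

lemma Fil.aeval (h : Fil w v n F) (Ψ : Polynomial K) :
    Fil w v n (Polynomial.aeval (_root_.Dy K) Ψ F) := by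
  induction Ψ using Polynomial.induction_on' with
  | add p q hp hq => rw [map_add]; exact hp.add hq
  | monomial m a =>
    rw [Polynomial.aeval_monomial, ← Algebra.smul_def]
    refine Fil.smul a ((h.Dy_pow m).mono ?_)
    have : (0:ℤ) ≤ m * v := by positivity
    linarith

lemma exists_Fil (w v : ℕ) (F : MvPolynomial (Fin 2) K) : ∃ n : ℕ, Fil w v n F := by
  refine ⟨F.support.sup (fun d => w * d 0 + v * d 1), fun i j hij => ?_⟩
  by_contra hne
  have : pt i j ∈ F.support := by simpa [cf, mem_support_iff] using hne
  have := Finset.le_sup (f := fun d : Fin 2 →₀ ℕ => w * d 0 + v * d 1) this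
  simp at this
  zify at this
  omega

lemma Fil.eq_zero (h : Fil w v n F) (hn : n < 0) : F = 0 :=
  cf_ext fun i j => h i j (lt_of_lt_of_le hn (by positivity))

lemma conclude (L : Module.End K (MvPolynomial (Fin 2) K)) (w v : ℕ) (δ n : ℤ)
    (hL : ∀ (k : ℤ) F, Fil w v k F → Fil w v (k - δ) (L F))
    (P : MvPolynomial (Fin 2) K) (hP : Fil w v n P) (hn : n < δ) (Q : MvPolynomial (Fin 2) K) :
    ∃ N : ℕ, ∀ m : ℕ, N ≤ m → (L ^ m) (P ^ m * Q) = 0 := by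
  obtain ⟨q, hq⟩ := exists_Fil w v Q
  have hpow : ∀ (m : ℕ) (k : ℤ) F, Fil w v k F → Fil w v (k - m * δ) ((L ^ m) F) := by
    intro m
    induction m with
    | zero => intro k F h; simpa using h
    | succ m ih =>
      intro k F h
      rw [pow_succ, Module.End.mul_apply]
      convert ih _ _ (hL _ _ h) using 1
      push_cast; ring
  refine ⟨q + 1, fun m hm => ?_⟩
  refine (hpow m _ _ ((hP.pow m).mul hq)).eq_zero ?_
  zify at hm
  nlinarith

/-- Factored form of the operator. -/
lemma Lam_apply (r : ℕ) (Ψ : Polynomial K) (F : MvPolynomial (Fin 2) K) :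
    Lam K (Polynomial.X ^ r * Ψ) F = Dx K (Dy K F)
      - Polynomial.aeval (Dy K) Ψ ((Dy K ^ (r+1)) F) := by
  rw [Lam, map_mul, map_pow, Polynomial.aeval_X, Module.End.mul_apply, LinearMap.sub_apply,
    pow_succ]
  have : Commute (Dy K ^ r) (Polynomial.aeval (Dy K) Ψ) := by
    have := (Polynomial.aeval (R := K) (Dy K)).commutes
    have h := mul_comm (Polynomial.X ^ r) Ψ
    have := congrArg (Polynomial.aeval (Dy K)) h
    simpa [Commute, SemiconjBy] using this
  rw [this.eq]; rfl


lemma pert_one (L A : Module.End K (MvPolynomial (Fin 2) K)) (w v : ℕ) (δ D : ℤ)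
    (hB : ∀ (k : ℤ) F, Fil w v k F → Fil w v (k - δ - 1) (L F - A F))
    (P : MvPolynomial (Fin 2) K) (hP : Fil w v D P) (h : L P = 0)
    (i j : ℕ) (hij : (w * i + v * j : ℤ) = D - δ) : cf (A P) i j = 0 := by
  have := hB _ _ hP i j (by omega)
  rw [h] at this
  simpa using this

lemma pert_two (L A : Module.End K (MvPolynomial (Fin 2) K)) (w v : ℕ) (δ D : ℤ)
    (hA : ∀ (k : ℤ) F, Fil w v k F → Fil w v (k - δ) (A F))
    (hB : ∀ (k : ℤ) F, Fil w v k F → Fil w v (k - δ - 1) (L F - A F))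
    (P : MvPolynomial (Fin 2) K) (hP : Fil w v D P) (h : L (L P) = 0)
    (i j : ℕ) (hij : (w * i + v * j : ℤ) = D - 2 * δ) : cf (A (A P)) i j = 0 := by
  have hL : Fil w v (D - δ) (L P) := by
    have := ((hB _ _ hP).mono (k := D - δ) (by omega)).add (hA _ _ hP)
    simpa using this
  have h1 := hB _ _ hL
  have h2 := hA _ _ (hB _ _ hP)
  have h3 := (h1.mono (k := D - 2 * δ - 1) (by omega)).add
    (h2.mono (k := D - 2 * δ - 1) (by omega))
  have := h3 i j (by omega)
  rw [h, map_sub] at this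
  simp only [cf_add, cf_sub, cf_zero] at this
  linear_combination -this

/-- leading operator for the weight (r, 1) -/
noncomputable def Ar (r : ℕ) (c : K) : Module.End K (MvPolynomial (Fin 2) K) :=
  Dx K * Dy K - c • Dy K ^ (r + 1)

lemma Ar_apply (r : ℕ) (c : K) (F : MvPolynomial (Fin 2) K) :
    Ar r c F = Dx K (Dy K F) - c • (Dy K ^ (r+1)) F := rfl

lemma Fil.Ar {r : ℕ} (c : K) (h : Fil r 1 n F) : Fil r 1 (n - (r + 1)) (Ar r c F) := by
  rw [Ar_apply]
  refine (h.Dy.Dx.mono ?_).sub (((h.Dy_pow (r+1)).mono ?_).smul c)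
  · push_cast; omega
  · push_cast; omega

lemma Lam_sub_Ar {r : ℕ} (Ψ : Polynomial K) (h : Fil r 1 n F) :
    Fil r 1 (n - (r + 1) - 1) (Lam K (Polynomial.X ^ r * Ψ) F - GVC.Ar r (Ψ.coeff 0) F) := by
  rw [Lam_apply, Ar_apply]
  have : Polynomial.aeval (Dy K) Ψ ((Dy K ^ (r+1)) F) =
      Polynomial.aeval (Dy K) Ψ.divX (Dy K ((Dy K ^ (r+1)) F)) +
        Ψ.coeff 0 • (Dy K ^ (r+1)) F := by
    conv_lhs => rw [← Polynomial.divX_mul_X_add Ψ]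
    rw [map_add, map_mul, Polynomial.aeval_X, Polynomial.aeval_C]
    rfl
  rw [this]
  have h1 := (((h.Dy_pow (r+1)).Dy).aeval Ψ.divX).smul (-1)
  convert h1.mono (k := n - (r+1) - 1) _ using 1
  · rw [neg_one_smul]; abel
  · push_cast; omega

lemma Fil.Lam {w v r : ℕ} (Ψ : Polynomial K) (h : Fil w v n F) (δ : ℤ) (h1 : δ ≤ w + v)
    (h2 : δ ≤ (r + 1) * v) : Fil w v (n - δ) (Lam K (Polynomial.X ^ r * Ψ) F) := by
  rw [Lam_apply]
  refine (h.Dy.Dx.mono ?_).sub (((h.Dy_pow (r+1)).aeval Ψ).mono ?_)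
  · omega
  · push_cast; omega

lemma Lam_sub_DxDy {w v r : ℕ} (Ψ : Polynomial K) (h : Fil w v n F) (hw : w < r * v) :
    Fil w v (n - (w + v) - 1) (Lam K (Polynomial.X ^ r * Ψ) F - (Dx K * Dy K) F) := by
  rw [Lam_apply]
  have h1 := ((h.Dy_pow (r+1)).aeval Ψ).smul (-1)
  convert h1.mono (k := n - (w + v) - 1) _ using 1
  · rw [neg_one_smul, Module.End.mul_apply]; abel
  · zify at hw
    push_cast; linarith

lemma cf_Ar (r : ℕ) (c : K) (F : MvPolynomial (Fin 2) K) (i j : ℕ) :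
    cf (Ar r c F) i j = (j + 1) * ((i + 1) * cf F (i+1) (j+1)
      - c * ((j + r + 1).descFactorial r : ℕ) * cf F i (j + r + 1)) := by
  rw [Ar_apply, cf_sub, cf_smul, cf_Dx, cf_Dy, cf_Dy_pow]
  have : (j + (r + 1)).descFactorial (r + 1) = (j + 1) * (j + r + 1).descFactorial r := by
    rw [Nat.descFactorial_succ, show j + (r+1) - r = j + 1 by omega, ← add_assoc]
  rw [this]
  push_cast
  rw [← add_assoc]
  ring

lemma cf_Ar_Ar (r : ℕ) (c : K) (F : MvPolynomial (Fin 2) K) (i j : ℕ) :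
    cf (Ar r c (Ar r c F)) i j = (j + 1) * (j + 2) * ((i + 1) * (i + 2) * cf F (i+2) (j+2)
      - 2 * (i + 1) * c * ((j + r + 2).descFactorial r : ℕ) * cf F (i+1) (j + r + 2)
      + c ^ 2 * ((j + r + 2).descFactorial r : ℕ) * ((j + 2 * r + 2).descFactorial r : ℕ)
        * cf F i (j + 2 * r + 2)) := by
  rw [cf_Ar, cf_Ar, cf_Ar]
  have key : (j + r + 2) * (j + r + 1).descFactorial r
      = (j + 2) * (j + r + 2).descFactorial r := by
    rw [← Nat.succ_descFactorial_succ, Nat.descFactorial_succ]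
    congr 1; omega
  have key' : ((j : K) + r + 2) * ((j + r + 1).descFactorial r : ℕ)
      = (j + 2) * ((j + r + 2).descFactorial r : ℕ) := by
    have := congrArg (Nat.cast (R := K)) key
    push_cast at this
    exact this
  rw [show j + 1 + 1 = j + 2 by omega, show i + 1 + 1 = i + 2 by omega,
    show j + 1 + r + 1 = j + r + 2 by omega, show j + r + 1 + 1 = j + r + 2 by omega,
    show j + r + 1 + r + 1 = j + 2 * r + 2 by omega]
  push_cast
  linear_combination (-(j+1) * c * ((i + 1) * cf F (i+1) (j + r + 2)
    - c * ((j + 2 * r + 2).descFactorial r : ℕ) * cf F i (j + 2 * r + 2))) * key'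

/-- top coefficients -/
noncomputable def tp (r D : ℕ) (P : MvPolynomial (Fin 2) K) (a : ℕ) : K :=
  if r * a ≤ D then cf P a (D - r * a) else 0

lemma cf_sq_top (r D : ℕ) (P : MvPolynomial (Fin 2) K) (hP : Fil r 1 D P) (k N : ℕ)
    (hN : r * k + N = 2 * D) :
    cf (P ^ 2) k N = ∑ a ∈ Finset.HasAntidiagonal.antidiagonal k, tp r D P a.1 * tp r D P a.2 := by
  rw [sq, cf_mul]
  refine Finset.sum_congr rfl ?_
  rintro ⟨a, a'⟩ ha
  simp only [Finset.HasAntidiagonal.mem_antidiagonal] at ha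
  subst ha
  rw [mul_add] at hN
  have hP' : ∀ i j, D < r * i + j → cf P i j = 0 := by
    intro i j hij
    exact hP i j (by zify at hij; push_cast; linarith)
  simp only [tp]
  by_cases h1 : r * a ≤ D
  · by_cases h2 : r * a' ≤ D
    · rw [if_pos h1, if_pos h2]
      rw [Finset.sum_eq_single (D - r * a, D - r * a')]
      · rintro ⟨b, b'⟩ hb hne
        simp only [Finset.HasAntidiagonal.mem_antidiagonal] at hb
        simp only
        by_cases h3 : D < r * a + b
        · rw [hP' _ _ h3, zero_mul]
        · by_cases h4 : D < r * a' + b'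
          · rw [hP' _ _ h4, mul_zero]
          · exfalso; apply hne
            ext <;> simp <;> omega
      · intro h
        exfalso; apply h
        simp only [Finset.HasAntidiagonal.mem_antidiagonal]
        omega
    · rw [if_neg h2, mul_zero]
      refine Finset.sum_eq_zero fun b hb => ?_
      rw [hP' a' b.2 (by omega), mul_zero]
  · rw [if_neg h1, zero_mul]
    refine Finset.sum_eq_zero fun b hb => ?_
    rw [hP' a b.1 (by omega), zero_mul]

lemma desc_two (D r : ℕ) : 2 ^ r * D.descFactorial r ≤ (2 * D).descFactorial r := by
  induction r with
  | zero => simp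
  | succ r ih =>
    rw [Nat.descFactorial_succ, Nat.descFactorial_succ]
    calc 2 ^ (r+1) * ((D - r) * D.descFactorial r)
        = (2 * (D - r)) * (2 ^ r * D.descFactorial r) := by ring
      _ ≤ (2 * D - r) * (2 * D).descFactorial r := by
        apply Nat.mul_le_mul _ ih
        omega

lemma desc_four (D r : ℕ) (hr : 2 ≤ r) : 4 * D.descFactorial r ≤ (2 * D).descFactorial r := by
  refine le_trans (Nat.mul_le_mul_right _ ?_) (desc_two D r)
  calc 4 = 2 ^ 2 := rfl
    _ ≤ 2 ^ r := Nat.pow_le_pow_right (by norm_num) hr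

lemma desc_special (r : ℕ) (hr : 2 ≤ r) :
    6 * (2 * r).descFactorial r ^ 2 + (4 * r).descFactorial r * (3 * r).descFactorial r
      ≠ 6 * (3 * r).descFactorial r * (2 * r).descFactorial r := by
  rcases eq_or_lt_of_le hr with rfl | h3
  · decide
  · have h8 : 8 * (2 * r).descFactorial r ≤ (4 * r).descFactorial r := by
      have := desc_two (2 * r) r
      rw [show 2 * (2 * r) = 4 * r by ring] at this
      refine le_trans (Nat.mul_le_mul_right _ ?_) this
      calc 8 = 2 ^ 3 := rfl
        _ ≤ 2 ^ r := Nat.pow_le_pow_right (by norm_num) h3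
    have hpos : 0 < (2 * r).descFactorial r := by
      rw [Nat.pos_iff_ne_zero, Ne, Nat.descFactorial_eq_zero_iff_lt]; omega
    have := Nat.mul_le_mul_right ((3 * r).descFactorial r) h8
    have h4 : 0 < (2 * r).descFactorial r ^ 2 := by positivity
    nlinarith [Nat.zero_le ((3 * r).descFactorial r * (2 * r).descFactorial r)]

/-- Lemma B -/
lemma p0_zero [CharZero K] (r : ℕ) (hr : 2 ≤ r) (Ψ : Polynomial K) (hc : Ψ.coeff 0 ≠ 0)
    (P : MvPolynomial (Fin 2) K)
    (h1 : Lam K (Polynomial.X ^ r * Ψ) P = 0)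
    (h2 : Lam K (Polynomial.X ^ r * Ψ) (Lam K (Polynomial.X ^ r * Ψ) (P ^ 2)) = 0)
    (d : ℕ) (hP : Fil r 1 ((r + 1 + d : ℕ) : ℤ) P) : cf P 0 (r + 1 + d) = 0 := by
  by_contra hp0
  set c := Ψ.coeff 0 with hcdef
  set D := r + 1 + d with hD
  have R1 : ∀ i j : ℕ, r * i + j + r + 1 = D →
      (i + 1) * cf P (i+1) (j+1) = c * ((j + r + 1).descFactorial r : ℕ) * cf P i (j + r + 1) := by
    intro i j hij
    have := pert_one (Lam K (Polynomial.X ^ r * Ψ)) (Ar r c) r 1 (r + 1) D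
      (fun k F hF => Lam_sub_Ar Ψ hF) P hP h1 i j (by zify at hij; push_cast; linarith)
    rw [cf_Ar] at this
    have hj : (j : K) + 1 ≠ 0 := by exact_mod_cast Nat.succ_ne_zero j
    exact sub_eq_zero.mp ((mul_eq_zero.mp this).resolve_left hj)
  have hP2 : Fil r 1 (2 * D : ℤ) (P ^ 2) := by
    simpa using hP.pow 2
  have R2 : ∀ i j : ℕ, r * i + j + 2 * r + 2 = 2 * D →
      (i + 1) * (i + 2) * cf (P^2) (i+2) (j+2)
      - 2 * (i + 1) * c * ((j + r + 2).descFactorial r : ℕ) * cf (P^2) (i+1) (j + r + 2)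
      + c ^ 2 * ((j + r + 2).descFactorial r : ℕ) * ((j + 2 * r + 2).descFactorial r : ℕ)
        * cf (P^2) i (j + 2 * r + 2) = 0 := by
    intro i j hij
    have := pert_two (Lam K (Polynomial.X ^ r * Ψ)) (Ar r c) r 1 (r + 1) (2 * D)
      (fun k F hF => hF.Ar c)
      (fun k F hF => Lam_sub_Ar Ψ hF) (P^2) hP2 h2 i j (by zify at hij; push_cast; linarith)
    rw [cf_Ar_Ar] at this
    have hj : ((j : K) + 1) * (j + 2) ≠ 0 := by
      have : (((j + 1) * (j + 2) : ℕ) : K) ≠ 0 := by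
        exact_mod_cast (by positivity : (j + 1) * (j + 2) ≠ 0)
      exact_mod_cast this
    exact (mul_eq_zero.mp this).resolve_left hj
  set p := tp r D P with hp
  have e0 : p 0 = cf P 0 D := by simp [hp, tp]
  have e1 : p 1 = cf P 1 (d + 1) := by
    simp only [hp, tp]; rw [if_pos (by omega)]; congr 1; omega
  have r1 : p 1 = c * (D.descFactorial r : ℕ) * p 0 := by
    have := R1 0 d (by omega)
    rw [show d + r + 1 = D by omega] at this
    rw [e0, e1]
    simpa using this
  have g0 : cf (P^2) 0 (2 * D) = p 0 ^ 2 := by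
    rw [cf_sq_top r D P hP 0 (2 * D) (by omega)]
    simp [← hp, sq]
  have g1 : cf (P^2) 1 (2 * d + r + 2) = 2 * p 0 * p 1 := by
    rw [cf_sq_top r D P hP 1 _ (by omega)]
    simp [← hp, Finset.Nat.antidiagonal_succ]; ring
  have g2 : cf (P^2) 2 (2 * d + 2) = 2 * p 0 * p 2 + p 1 ^ 2 := by
    rw [cf_sq_top r D P hP 2 _ (by omega)]
    simp [← hp, Finset.Nat.antidiagonal_succ]; ring
  have r2 := R2 0 (2 * d) (by omega)
  rw [show 2 * d + 2 * r + 2 = 2 * D by omega] at r2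
  simp only [zero_add, Nat.cast_zero] at r2
  rw [g0, g1, g2, r1] at r2
  rw [← e0] at hp0
  set B := (2 * d + r + 2).descFactorial r with hB
  set A := (2 * D).descFactorial r with hA
  set q := D.descFactorial r with hq
  have hqpos : 0 < q := by
    rw [Nat.pos_iff_ne_zero, Ne, Nat.descFactorial_eq_zero_iff_lt]; omega
  by_cases hD2 : D = 2 * r
  · have g3 : cf (P^2) 3 r = 2 * p 1 * p 2 := by
      have e3 : p 3 = 0 := by
        simp only [hp, tp]; rw [if_neg (by omega)]
      rw [cf_sq_top r D P hP 3 _ (by omega)]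
      simp [← hp, Finset.Nat.antidiagonal_succ, e3]; ring
    have r3 := R2 1 (r - 2) (by omega)
    rw [show r - 2 + 2 = r by omega, show r - 2 + r + 2 = 2 * d + 2 by omega,
      show r - 2 + 2 * r + 2 = 2 * d + r + 2 by omega, ← hB,
      show (2 * d + 2).descFactorial r = q by rw [hq]; congr 1; omega] at r3
    norm_num at r3
    rw [g1, g2, g3, r1] at r3
    have hz : c * q * p 0 ≠ 0 := by
      have : (q : K) ≠ 0 := by exact_mod_cast hqpos.ne'
      positivity
    have r4 : 2 * p 2 = 2 * c^2 * q^2 * p 0 - c^2 * B * q * p 0 := by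
      apply mul_left_cancel₀ hz
      linear_combination r3 / 2
    have r5 : (c^2 * (p 0)^2) * (6 * (q:K)^2 + A * B - 6 * B * q) = 0 := by
      linear_combination r2 - 2 * p 0 * r4
    have r6 : 6 * (q:K)^2 + A * B - 6 * B * q = 0 :=
      (mul_eq_zero.mp r5).resolve_left (by positivity)
    have r7 : 6 * q ^ 2 + A * B = 6 * B * q := by
      have := sub_eq_zero.mp r6
      exact_mod_cast this
    apply desc_special r hr
    rw [show 4 * r = 2 * D by omega, show 3 * r = 2 * d + r + 2 by omega,
      show 2 * r = D by omega]
    exact r7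
  · have : ∃ q' : ℕ, 2 * p 2 = c ^ 2 * q' * q * p 0 := by
      rcases lt_or_gt_of_ne hD2 with hlt | hgt
      · refine ⟨0, ?_⟩
        simp only [hp, tp]; rw [if_neg (by omega)]; simp
      · refine ⟨(D - r).descFactorial r, ?_⟩
        have := R1 1 (D - 2 * r - 1) (by omega)
        rw [show D - 2 * r - 1 + r + 1 = d + 1 by omega, ← e1, r1,
          show d + 1 = D - r by omega] at this
        have e2 : p 2 = cf P 2 (D - 2 * r - 1 + 1) := by
          simp only [hp, tp]; rw [if_pos (by omega)]; congr 1; omega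
        rw [e2]
        norm_num at this
        linear_combination this
    obtain ⟨q', r4⟩ := this
    have r5 : (c^2 * (p 0)^2) * (2 * (q:K)^2 + 2 * q' * q + A * B - 4 * B * q) = 0 := by
      linear_combination r2 - 2 * p 0 * r4
    have r6 : 2 * (q:K)^2 + 2 * q' * q + A * B - 4 * B * q = 0 :=
      (mul_eq_zero.mp r5).resolve_left (by positivity)
    have r7 : 2 * q ^ 2 + 2 * q' * q + A * B = 4 * B * q := by
      have := sub_eq_zero.mp r6
      exact_mod_cast this
    have h4 : 4 * q ≤ A := desc_four D r hr
    have := Nat.mul_le_mul_right B h4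
    have h5 : 0 < q ^ 2 := by positivity
    nlinarith [Nat.zero_le (q' * q)]

lemma conclude_y (Φ : Polynomial K) (P : MvPolynomial (Fin 2) K) (hP : Fil 0 1 0 P)
    (Q : MvPolynomial (Fin 2) K) :
    ∃ N : ℕ, ∀ m : ℕ, N ≤ m → (Lam K Φ ^ m) (P ^ m * Q) = 0 := by
  refine conclude _ 0 1 1 0 (fun k F hF => ?_) P hP (by norm_num) Q
  have := hF.Lam (r := 0) Φ 1 (by norm_num) (by norm_num)
  simpa using this

lemma main_case [CharZero K] (r : ℕ) (hr : 2 ≤ r) (Ψ : Polynomial K)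
    (P : MvPolynomial (Fin 2) K)
    (hc : Ψ.coeff 0 ≠ 0 ∨ Fil 0 1 r P)
    (h1 : Lam K (Polynomial.X ^ r * Ψ) P = 0)
    (h2 : Lam K (Polynomial.X ^ r * Ψ) (Lam K (Polynomial.X ^ r * Ψ) (P ^ 2)) = 0)
    (Q : MvPolynomial (Fin 2) K) :
    ∃ N : ℕ, ∀ m : ℕ, N ≤ m → (Lam K (Polynomial.X ^ r * Ψ) ^ m) (P ^ m * Q) = 0 := by
  by_cases hlow : Fil r 1 r P
  · exact conclude _ r 1 (r + 1) r (fun k F hF => hF.Lam Ψ _ (by push_cast; omega)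
      (by push_cast; omega)) P hlow (by omega) Q
  -- the top weight
  have hex : ∃ D : ℕ, r < D ∧ Fil r 1 D P ∧ ∃ i j, r * i + j = D ∧ cf P i j ≠ 0 := by
    classical
    have hE := exists_Fil r 1 P
    have hs := Nat.find_spec hE
    have hm := fun m => Nat.find_min (m := m) hE
    set D := Nat.find hE
    have hrD : r < D := by
      by_contra hle
      exact hlow (hs.mono (by omega))
    refine ⟨D, hrD, hs, ?_⟩
    by_contra hno
    push Not at hno
    refine hm (D - 1) (by omega) fun i j hij => ?_
    by_cases hD : r * i + j = D
    · exact hno i j hD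
    · refine hs i j ?_
      have : D - 1 < r * i + j := by zify; push_cast at hij ⊢; linarith
      have : D < r * i + j := by omega
      zify at this; push_cast; linarith
  obtain ⟨D, hrD, hP, i₀, j₀, hij₀, hne₀⟩ := hex
  have hle : ∀ i j, cf P i j ≠ 0 → r * i + j ≤ D := by
    intro i j hij
    by_contra hlt
    push Not at hlt
    exact hij (hP i j (by zify at hlt; push_cast; linarith))
  obtain ⟨d, rfl⟩ : ∃ d, D = r + 1 + d := ⟨D - (r + 1), by omega⟩
  have hp0 : cf P 0 (r + 1 + d) = 0 := by
    rcases hc with hc | hc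
    · exact p0_zero r hr Ψ hc P h1 h2 d hP
    · exact hc _ _ (by push_cast; omega)
  have hmix : ∀ i j, r * i + (j + 1) = r + 1 + d → cf P i (j + 1) = 0 := by
    intro i
    induction i with
    | zero => intro j hj; rw [← hp0]; congr 1; omega
    | succ i ih =>
      intro j hj
      rw [mul_add, mul_one] at hj
      have := pert_one (Lam K (Polynomial.X ^ r * Ψ)) (Ar r (Ψ.coeff 0)) r 1 (r + 1)
        (r + 1 + d : ℕ)
        (fun k F hF => Lam_sub_Ar Ψ hF) P hP h1 i j (by zify at hj; push_cast; linarith)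
      rw [cf_Ar, ih (j + r) (by omega)] at this
      have hj : (j : K) + 1 ≠ 0 := by exact_mod_cast Nat.succ_ne_zero j
      have hi : (i : K) + 1 ≠ 0 := by exact_mod_cast Nat.succ_ne_zero i
      simpa [hj, hi] using this
  have hj₀ : j₀ = 0 := by
    by_contra hj
    obtain ⟨j, rfl⟩ := Nat.exists_eq_succ_of_ne_zero hj
    exact hne₀ (hmix i₀ j hij₀)
  subst hj₀
  rename' i₀ => a
  rw [add_zero] at hij₀
  have ha : 2 ≤ a := by
    by_contra hlt
    have : a ≤ 1 := by omega
    have := Nat.mul_le_mul_left r this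
    omega
  have hstrict : ∀ i j, cf P i j ≠ 0 → 1 ≤ j → r * i + j < r * a := by
    intro i j hij hj
    refine lt_of_le_of_ne (by rw [hij₀]; exact hle i j hij) fun he => hij ?_
    obtain ⟨j, rfl⟩ := Nat.exists_eq_add_of_le' hj
    exact hmix i j (by omega)
  have hlta : ∀ i j, cf P i j ≠ 0 → 1 ≤ j → i < a := by
    intro i j hij hj
    have := hstrict i j hij hj
    exact Nat.lt_of_mul_lt_mul_left (a := r) (by omega)
  have hlea : ∀ i, cf P i 0 ≠ 0 → i ≤ a := by
    intro i hi
    have := hle i 0 hi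
    by_contra hlt
    have h3 := Nat.mul_le_mul_left r (show a + 1 ≤ i by omega)
    rw [mul_add] at h3
    omega
  by_cases hy : ∀ i j, 1 ≤ j → cf P i j = 0
  · refine conclude_y _ P (fun i j hij => hy i j ?_) Q
    push_cast at hij; omega
  -- the maximal slope
  have hmax : ∃ i j, cf P i j ≠ 0 ∧ 1 ≤ j ∧ ∀ i' j', cf P i' j' ≠ 0 → 1 ≤ j' →
      j' * (a - i) ≤ j * (a - i') := by
    push Not at hy
    obtain ⟨i, j, hj, hij⟩ := hy
    obtain ⟨e, he, hemax⟩ := Finset.exists_max_image (P.support.filter (fun e => 1 ≤ e 1))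
      (fun e => (e 1 : ℚ) / ((a - e 0 : ℕ) : ℚ)) ⟨pt i j, by
        simpa [mem_support_iff] using ⟨hij, hj⟩⟩
    rw [Finset.mem_filter, mem_support_iff] at he
    have hce : cf P (e 0) (e 1) ≠ 0 := by unfold cf; rw [← eq_pt]; exact he.1
    refine ⟨e 0, e 1, hce, he.2, fun i' j' hij' hj' => ?_⟩
    have := hemax (pt i' j') (by
        simpa [mem_support_iff] using ⟨hij', hj'⟩)
    simp only [pt_zero, pt_one] at this
    have p1 : 0 < a - e 0 := by have := hlta _ _ hce he.2; omega
    have p2 : 0 < a - i' := by have := hlta _ _ hij' hj'; omega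
    rw [div_le_div_iff₀ (by exact_mod_cast p2) (by exact_mod_cast p1)] at this
    exact_mod_cast this
  obtain ⟨i, j, hij, hj, hslope⟩ := hmax
  have hia := hlta i j hij hj
  obtain ⟨v, rfl⟩ : ∃ v, a = i + v := ⟨a - i, by omega⟩
  rw [Nat.add_sub_cancel_left] at hslope
  have hvpos : 0 < v := by omega
  have hwv : j < r * v := by
    have := hstrict i j hij hj
    rw [mul_add] at this; omega
  have hPw : Fil j v ((i + v) * j : ℕ) P := by
    intro i' j' hlt
    by_contra hne
    rcases Nat.eq_zero_or_pos j' with rfl | hj'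
    · have := Nat.mul_le_mul_left j (hlea i' hne)
      zify at this; push_cast at hlt; nlinarith
    · have h3 := hslope i' j' hne hj'
      have h4 := hlta i' j' hne hj'
      obtain ⟨u, hu⟩ : ∃ u, i + v = i' + u := ⟨i + v - i', by omega⟩
      rw [hu, Nat.add_sub_cancel_left] at h3
      rw [hu] at hlt
      zify at h3; push_cast at hlt; nlinarith
  have hmix2 : ∀ i' j', j * (i' + 1) + v * (j' + 1) = (i + v) * j → cf P (i' + 1) (j' + 1) = 0 := by
    intro i' j' he
    have := pert_one (Lam K (Polynomial.X ^ r * Ψ)) (Dx K * Dy K) j v (j + v)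
      ((i + v) * j : ℕ)
      (fun k F hF => Lam_sub_DxDy Ψ hF hwv) P hPw h1 i' j' (by
        zify at he; push_cast; linarith)
    rw [Module.End.mul_apply, cf_Dx, cf_Dy] at this
    have hj : (j' : K) + 1 ≠ 0 := by exact_mod_cast Nat.succ_ne_zero j'
    have hi : (i' : K) + 1 ≠ 0 := by exact_mod_cast Nat.succ_ne_zero i'
    simpa [hj, hi] using this
  have hi0 : i = 0 := by
    by_contra hi
    obtain ⟨i', rfl⟩ := Nat.exists_eq_succ_of_ne_zero hi
    obtain ⟨j', rfl⟩ := Nat.exists_eq_add_of_le' hj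
    exact hij (hmix2 i' j' (by simp only [Nat.succ_eq_add_one]; ring))
  subst hi0
  simp only [zero_add] at *
  by_cases hj1 : j = 1
  · subst hj1
    refine conclude _ 1 v (1 + v) v (fun k F hF => hF.Lam Ψ _ (by push_cast; omega)
      (by zify at hwv; push_cast; nlinarith)) P (by simpa using hPw) (by omega) Q
  exfalso
  have hP2 : Fil j v (2 * (v * j : ℕ) : ℤ) (P ^ 2) := by
    simpa using hPw.pow 2
  have h3 := pert_two (Lam K (Polynomial.X ^ r * Ψ)) (Dx K * Dy K) j v (j + v)
      (2 * (v * j : ℕ) : ℤ)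
      (fun k F hF => hF.Dy.Dx.mono (by omega))
      (fun k F hF => Lam_sub_DxDy Ψ hF hwv) (P ^ 2) hP2 h2 (v - 2) (j - 2) (by
        obtain ⟨v', rfl⟩ := Nat.exists_eq_add_of_le' ha
        obtain ⟨j', rfl⟩ := Nat.exists_eq_add_of_le' (show 2 ≤ j by omega)
        simp only [Nat.add_sub_cancel]
        push_cast; ring)
  rw [Module.End.mul_apply, Module.End.mul_apply, cf_Dx, cf_Dy, cf_Dx, cf_Dy,
    show v - 2 + 1 + 1 = v by omega, show j - 2 + 1 + 1 = j by omega] at h3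
  have hk : ∀ n : ℕ, (n : K) + 1 ≠ 0 := fun n => by exact_mod_cast Nat.succ_ne_zero n
  have h4 : cf (P ^ 2) v j = 0 := by
    simpa only [mul_eq_zero, hk, false_or] using h3
  have h5 : cf (P ^ 2) v j = 2 * (cf P v 0 * cf P 0 j) := by
    rw [sq, cf_mul, ← Finset.sum_product']
    rw [← Finset.sum_subset (s₁ := {((0, v), (j, 0)), ((v, 0), (0, j))})]
    · rw [Finset.sum_pair (by simp; omega)]
      ring
    · intro x hx
      simp only [Finset.mem_insert, Finset.mem_singleton] at hx
      rcases hx with rfl | rfl <;> simp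
    · rintro ⟨⟨a1, a2⟩, ⟨b1, b2⟩⟩ hx hnx
      simp only [Finset.mem_product, Finset.HasAntidiagonal.mem_antidiagonal] at hx
      obtain ⟨hx1, hx2⟩ := hx
      simp only
      by_contra hne
      obtain ⟨n1, n2⟩ := mul_ne_zero_iff.mp hne
      have q1 : j * a1 + v * b1 ≤ v * j := by
        by_contra hlt
        push Not at hlt
        exact n1 (hPw _ _ (by exact_mod_cast hlt))
      have q2 : j * a2 + v * b2 ≤ v * j := by
        by_contra hlt
        push Not at hlt
        exact n2 (hPw _ _ (by exact_mod_cast hlt))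
      have q3 : (j * a1 + v * b1) + (j * a2 + v * b2) = 2 * (v * j) := by
        rw [← hx1, ← hx2]; ring
      have q4 : j * a1 + v * b1 = v * j := by omega
      apply hnx
      have hjpos : 0 < j := by omega
      rcases Nat.eq_zero_or_pos a1 with rfl | ha1
      · have : b1 = j := Nat.eq_of_mul_eq_mul_left hvpos (by simpa using q4)
        simp; omega
      · rcases Nat.eq_zero_or_pos b1 with rfl | hb1
        · have : a1 = v := Nat.eq_of_mul_eq_mul_left hjpos (by rw [mul_comm j v]; simpa using q4)
          simp; omega
        · exfalso
          obtain ⟨a1, rfl⟩ := Nat.exists_eq_add_of_le' ha1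
          obtain ⟨b1, rfl⟩ := Nat.exists_eq_add_of_le' hb1
          exact n1 (hmix2 a1 b1 q4)
  rw [h4] at h5
  have := mul_ne_zero (two_ne_zero (α := K)) (mul_ne_zero hne₀ hij)
  exact this h5.symm

/-- nonzero constant term -/
lemma unit_case [CharZero K] (Φ : Polynomial K) (hΦ : Φ.coeff 0 ≠ 0)
    (P : MvPolynomial (Fin 2) K) (h1 : Lam K Φ P = 0) : Fil 0 1 0 P := by
  set G := Dy K P with hG
  have hN : ∀ n : ℤ, Fil 1 1 n G → Fil 1 1 (n - 1) G := by
    intro n h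
    have e : G = (Φ.coeff 0)⁻¹ • (Dx K G - Polynomial.aeval (Dy K) Φ.divX (Dy K G)) := by
      have e1 : Lam K Φ P = Dx K G - (Polynomial.aeval (Dy K) Φ.divX (Dy K G) + Φ.coeff 0 • G) := by
        rw [Lam, Module.End.mul_apply, LinearMap.sub_apply]
        conv_lhs => rw [← Polynomial.divX_mul_X_add Φ]
        rw [map_add, map_mul, Polynomial.aeval_X, Polynomial.aeval_C]
        rfl
      rw [h1] at e1
      have e2 : Dx K G - Polynomial.aeval (Dy K) Φ.divX (Dy K G) = Φ.coeff 0 • G := by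
        rw [← sub_eq_zero, e1]; abel
      rw [e2, smul_smul, inv_mul_cancel₀ hΦ, one_smul]
    rw [e]
    exact (h.Dx.sub (h.Dy.aeval _)).smul _
  obtain ⟨n, hn⟩ := exists_Fil 1 1 G
  have hk : ∀ k : ℕ, Fil 1 1 (n - k : ℤ) G := by
    intro k
    induction k with
    | zero => simpa using hn
    | succ k ih => exact (hN _ ih).mono (by push_cast; omega)
  have hG0 : G = 0 := (hk (n + 1)).eq_zero (by push_cast; omega)
  intro i j hij
  obtain ⟨j, rfl⟩ := Nat.exists_eq_add_of_le' (show 1 ≤ j by push_cast at hij; omega)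
  have := cf_Dy P i j
  rw [← hG, hG0, cf_zero] at this
  have hj : (j : K) + 1 ≠ 0 := by exact_mod_cast Nat.succ_ne_zero j
  exact (mul_eq_zero.mp this.symm).resolve_left hj

/-- no linear and constant term -/
lemma case_two [CharZero K] (Φ : Polynomial K) (h0 : Φ.coeff 0 = 0) (h0' : Φ.coeff 1 = 0)
    (P : MvPolynomial (Fin 2) K)
    (h1 : Lam K Φ P = 0) (h2 : Lam K Φ (Lam K Φ (P ^ 2)) = 0) (Q : MvPolynomial (Fin 2) K) :
    ∃ N : ℕ, ∀ m : ℕ, N ≤ m → (Lam K Φ ^ m) (P ^ m * Q) = 0 := by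
  by_cases hΦ : Φ = 0
  · obtain ⟨n, hn⟩ := exists_Fil 0 1 P
    have e : Φ = Polynomial.X ^ (n + 2) * 0 := by simp [hΦ]
    rw [e] at h1 h2 ⊢
    exact main_case (n + 2) (by omega) 0 P (Or.inr (hn.mono (by push_cast; omega))) h1 h2 Q
  · set r := Φ.natTrailingDegree
    obtain ⟨Ψ, hΨ⟩ : Polynomial.X ^ r ∣ Φ := by
      rw [Polynomial.X_pow_dvd_iff]
      exact fun d hd => Polynomial.coeff_eq_zero_of_lt_natTrailingDegree hd
    have hcr : Φ.coeff r ≠ 0 := by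
      have := Polynomial.trailingCoeff_nonzero_iff_nonzero.mpr hΦ
      exact this
    have hr : 2 ≤ r := by
      by_contra hlt
      have : r = 0 ∨ r = 1 := by omega
      rcases this with h | h <;> rw [h] at hcr <;> contradiction
    have hc : Ψ.coeff 0 ≠ 0 := by
      rw [hΨ] at hcr
      have := Polynomial.coeff_X_pow_mul Ψ r 0
      rw [zero_add] at this
      rwa [this] at hcr
    rw [hΨ] at h1 h2 ⊢
    exact main_case r hr Ψ P (Or.inl hc) h1 h2 Q

/-- the shear y ↦ y + c x -/
noncomputable def sh (c : K) : MvPolynomial (Fin 2) K →ₐ[K] MvPolynomial (Fin 2) K :=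
  MvPolynomial.aeval ![X 0, X 1 + C c * X 0]

lemma sh_sh (c : K) (F : MvPolynomial (Fin 2) K) : sh c (sh (-c) F) = F := by
  have : (sh c).comp (sh (-c)) = AlgHom.id K _ := by
    apply MvPolynomial.algHom_ext
    intro k
    fin_cases k <;> simp [sh]
  exact DFunLike.congr_fun this F

lemma Dy_sh (c : K) (F : MvPolynomial (Fin 2) K) : Dy K (sh c F) = sh c (Dy K F) := by
  induction F using MvPolynomial.induction_on with
  | C a => simp [Dy, sh]
  | add p q hp hq => simp only [map_add, hp, hq]
  | mul_X p k hp =>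
    change pderiv 1 (sh c p) = sh c (pderiv 1 p) at hp
    change pderiv 1 (sh c (p * X k)) = sh c (pderiv 1 (p * X k))
    rw [map_mul, pderiv_mul, pderiv_mul, map_add, map_mul, map_mul, hp]
    congr 2
    fin_cases k <;> simp [sh, pderiv_X]

lemma Dx_sh (c : K) (F : MvPolynomial (Fin 2) K) :
    Dx K (sh c F) = sh c (Dx K F) + c • sh c (Dy K F) := by
  induction F using MvPolynomial.induction_on with
  | C a => simp [Dx, Dy, sh]
  | add p q hp hq => simp only [map_add, hp, hq, smul_add]; abel
  | mul_X p k hp =>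
    change pderiv 0 (sh c p) = sh c (pderiv 0 p) + c • sh c (pderiv 1 p) at hp
    change pderiv 0 (sh c (p * X k)) = sh c (pderiv 0 (p * X k)) + c • sh c (pderiv 1 (p * X k))
    rw [map_mul, pderiv_mul, pderiv_mul, pderiv_mul, map_add, map_add, map_mul, map_mul, map_mul,
      map_mul, hp]
    fin_cases k <;> simp [sh, pderiv_X, smul_eq_C_mul] <;> ring

lemma aeval_sh (c : K) (Ψ : Polynomial K) (F : MvPolynomial (Fin 2) K) :
    Polynomial.aeval (Dy K) Ψ (sh c F) = sh c (Polynomial.aeval (Dy K) Ψ F) := by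
  have hp : ∀ m : ℕ, (Dy K ^ m) (sh c F) = sh c ((Dy K ^ m) F) := by
    intro m
    induction m with
    | zero => rfl
    | succ m ih => rw [pow_succ', Module.End.mul_apply, Module.End.mul_apply, ih, Dy_sh]
  induction Ψ using Polynomial.induction_on' with
  | add p q hp hq => simp only [map_add, LinearMap.add_apply, hp, hq]
  | monomial m a =>
    rw [Polynomial.aeval_monomial, ← Algebra.smul_def, LinearMap.smul_apply, LinearMap.smul_apply,
      hp, map_smul]

lemma Lam_sh (c : K) (Φ : Polynomial K) (F : MvPolynomial (Fin 2) K) :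
    Lam K Φ (sh c F) = sh c (Lam K (Φ - Polynomial.C c * Polynomial.X) F) := by
  simp only [Lam, Module.End.mul_apply, LinearMap.sub_apply, map_sub, map_mul,
    Polynomial.aeval_X, Polynomial.aeval_C, Dy_sh, Dx_sh, aeval_sh, Algebra.algebraMap_eq_smul_one,
    LinearMap.smul_apply, Module.End.one_apply, map_smul]
  abel

lemma Lam_pow_sh (c : K) (Φ : Polynomial K) (m : ℕ) (F : MvPolynomial (Fin 2) K) :
    (Lam K Φ ^ m) (sh c F) = sh c ((Lam K (Φ - Polynomial.C c * Polynomial.X) ^ m) F) := by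
  induction m with
  | zero => rfl
  | succ m ih => rw [pow_succ', pow_succ', Module.End.mul_apply, Module.End.mul_apply, ih, Lam_sh]

lemma sh_inj (c : K) {F : MvPolynomial (Fin 2) K} (h : sh c F = 0) : F = 0 := by
  have := sh_sh (-c) F
  rw [neg_neg, h, map_zero] at this
  exact this.symm

end GVC

theorem stmt11 (K : Type*) [Field K] [CharZero K] (Φ : Polynomial K)
    (P : MvPolynomial (Fin 2) K)
    (h : ∀ m : ℕ, 1 ≤ m → (Lam K Φ ^ m) (P ^ m) = 0) :
    ∀ Q : MvPolynomial (Fin 2) K, ∃ N : ℕ, ∀ m : ℕ, N ≤ m →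
      (Lam K Φ ^ m) (P ^ m * Q) = 0 := by
  intro Q
  by_cases h0 : Φ.coeff 0 = 0
  · set c := Φ.coeff 1 with hc
    set Φ' := Φ - Polynomial.C c * Polynomial.X with hΦ'
    set P' := GVC.sh (-c) P
    set Q' := GVC.sh (-c) Q
    have hP : P = GVC.sh c P' := (GVC.sh_sh c P).symm
    have hQ : Q = GVC.sh c Q' := (GVC.sh_sh c Q).symm
    have h' : ∀ m : ℕ, 1 ≤ m → (Lam K Φ' ^ m) (P' ^ m) = 0 := by
      intro m hm
      apply GVC.sh_inj c
      rw [← GVC.Lam_pow_sh, map_pow, ← hP]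
      exact h m hm
    obtain ⟨N, hN⟩ := GVC.case_two Φ' (by simp [hΦ', h0]) (by simp [hΦ', hc]) P'
      (by simpa using h' 1 le_rfl)
      (by have := h' 2 (by norm_num); rwa [pow_two (Lam K Φ'), Module.End.mul_apply] at this) Q'
    refine ⟨N, fun m hm => ?_⟩
    have := GVC.Lam_pow_sh c Φ m (P' ^ m * Q')
    rw [← hΦ', hN m hm, map_mul, map_pow, ← hP, ← hQ, map_zero] at this
    exact this
  · exact GVC.conclude_y Φ P (GVC.unit_case Φ h0 P (by simpa using h 1 le_rfl)) Q
end
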